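/- Suppose λ, μ, ν are partitions with at most n parts and N_{μ,ν,λ} > 0. Then the Horn inequalities hold: for every d < n and all subsets I, J, K of {1,...,n} of cardinality d with c^{τ(K)}_{τ(I),τ(J)} > 0, one has Σ_{k∈K} λ_k ≤ Σ_{i∈I} μ_i + Σ_{j∈J} ν_j. -/

import Mathlib

open YoungDiagram

/-- An LR (Littlewood–Richardson) filling witnessing the Littlewood–Richardson
coefficient `c^lam_{μ,ν}`: a ballot (lattice-word) semistandard filling of the skew
shape `lam/μ` with content `ν`.  The entry in row `i`, column `j` is `T i j`;
entries are `≥ 1` on the cells of `lam/μ` and `0` elsewhere. -/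
structure LRFilling (μ ν lam : YoungDiagram) : Type where
  sub : μ ≤ lam
  T : ℕ → ℕ → ℕ
  supp : ∀ i j, T i j ≠ 0 ↔ ((i, j) ∈ lam ∧ (i, j) ∉ μ)
  rows_weak : ∀ i j₁ j₂, j₁ ≤ j₂ → T i j₁ ≠ 0 → T i j₂ ≠ 0 → T i j₁ ≤ T i j₂
  cols_strict : ∀ i₁ i₂ j, i₁ < i₂ → T i₁ j ≠ 0 → T i₂ j ≠ 0 → T i₁ j < T i₂ j
  content : ∀ k : ℕ, Nat.card {p : ℕ × ℕ // T p.1 p.2 = k + 1} = ν.rowLen k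
  ballot : ∀ i j k : ℕ,
    Nat.card {p : ℕ × ℕ // (p.1 < i ∨ (p.1 = i ∧ j ≤ p.2)) ∧ T p.1 p.2 = k + 2} ≤
      Nat.card {p : ℕ × ℕ // (p.1 < i ∨ (p.1 = i ∧ j ≤ p.2)) ∧ T p.1 p.2 = k + 1}

/-- The Littlewood–Richardson coefficient `c^lam_{μ,ν}`. -/
noncomputable def lrCoeff (μ ν lam : YoungDiagram) : ℕ := Nat.card (LRFilling μ ν lam)

/-- The Newell–Littlewood number
`N_{μ,ν,lam} = Σ_{α,β,γ} c^μ_{α,β} c^ν_{α,γ} c^lam_{β,γ}`,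
realized as the cardinality of the set of triples of LR fillings over all `α,β,γ`. -/
noncomputable def NL (μ ν lam : YoungDiagram) : ℕ :=
  Nat.card (Σ α β γ : YoungDiagram,
    (LRFilling α β μ × LRFilling α γ ν × LRFilling β γ lam))



/-! ### Chains of partial-sum functions and the octahedron recurrence -/

/-- `x ⊂ y` is a horizontal strip (in terms of partial sums of row lengths). -/
def HStrip (x y : ℕ → ℤ) : Prop :=
  (∀ r, x (r + 1) - x r ≤ y (r + 1) - y r) ∧ (∀ r, y (r + 2) - y (r + 1) ≤ x (r + 1) - x r)

/-- Ballot condition for two successive horizontal strips. -/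
def HBal (x y z : ℕ → ℤ) : Prop := ∀ r, z (r + 1) - y (r + 1) ≤ y r - x r

/-- Octahedron recurrence. -/
def HOct (a b A B : ℕ → ℤ) : Prop :=
  ∀ r, A (r + 1) + b (r + 1) = max (a (r + 1) + B (r + 1)) (a r + B (r + 2))

theorem HOct.strip {a b A B : ℕ → ℤ} (ha : a 0 = 0) (hb : b 0 = 0) (hA : A 0 = 0) (hB : B 0 = 0)
    (h1 : HStrip a b) (h2 : HStrip b B) (h : HOct a b A B) : HStrip a A ∧ HStrip A B := by
  obtain ⟨h11, h12⟩ := h1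
  obtain ⟨h21, h22⟩ := h2
  refine ⟨⟨?_, ?_⟩, ⟨?_, ?_⟩⟩
  · rintro (_ | r)
    · have := h 0; have := h11 0; have := h21 0; have := h12 0; have := h22 0
      simp only [zero_add] at *; omega
    · have := h r; have := h (r+1); have := h11 (r+1); have := h21 (r+1); have := h12 r
      have := h22 r; have := h22 (r+1); have := h12 (r+1)
      simp only [add_assoc, Nat.reduceAdd] at *; omega
  · rintro r
    have := h r; have := h (r+1); have := h11 (r+1); have := h21 (r+1); have := h12 r
    have := h22 r; have := h22 (r+1); have := h12 (r+1); have := h11 r; have := h21 r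
    simp only [add_assoc, Nat.reduceAdd] at *; omega
  · rintro (_ | r)
    · have := h 0; have := h11 0; have := h21 0; have := h12 0; have := h22 0
      simp only [zero_add] at *; omega
    · have := h r; have := h (r+1); have := h11 (r+1); have := h21 (r+1); have := h12 r
      have := h22 r; have := h22 (r+1); have := h12 (r+1)
      simp only [add_assoc, Nat.reduceAdd] at *; omega
  · rintro (_ | r)
    · have := h 0; have := h11 0; have := h21 0; have := h12 0; have := h22 0
      simp only [zero_add] at *; omega
    · have := h r; have := h (r+1); have := h11 (r+1); have := h21 (r+1); have := h12 r
      have := h22 r; have := h22 (r+1); have := h12 (r+1)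
      simp only [add_assoc, Nat.reduceAdd] at *; omega

theorem HOct.bal_i {a b c A B C : ℕ → ℤ}
    (ha : a 0 = 0) (hb : b 0 = 0) (hA : A 0 = 0) (hB : B 0 = 0)
    (h : HBal a b c) (h1 : HOct a b A B) (h2 : HOct b c B C) : HBal A B C := by
  rintro (_ | r)
  · have := h 0; have := h2 0
    simp only [zero_add] at *; omega
  · have := h r; have := h (r+1); have := h1 r; have := h2 r; have := h2 (r+1)
    simp only [add_assoc, Nat.reduceAdd] at *; omega

theorem HOct.bal_j {a b c A B C : ℕ → ℤ}
    (ha : a 0 = 0) (hb : b 0 = 0) (hA : A 0 = 0) (hB : B 0 = 0)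
    (h : HBal a b c) (h1 : HOct A a B b) (h2 : HOct B b C c) : HBal A B C := by
  rintro (_ | r)
  · have := h 0; have := h 1; have := h1 0; have := h2 0
    simp only [zero_add, Nat.reduceAdd] at *; omega
  · have := h r; have := h (r+1); have := h (r+2); have := h1 r; have := h1 (r+1)
    have := h2 r; have := h2 (r+1)
    simp only [add_assoc, Nat.reduceAdd] at *; omega

/-- Move a strip through a chain, using the octahedron recurrence. -/
def pushF (a : ℕ → ℤ) (f : ℕ → ℕ → ℤ) : ℕ → ℕ → ℤ
  | 0 => a
  | j + 1 => fun r => match r with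
    | 0 => 0
    | r + 1 => max (pushF a f j (r + 1) + f (j + 1) (r + 1)) (pushF a f j r + f (j + 1) (r + 2))
        - f j (r + 1)

theorem pushF_oct (a : ℕ → ℤ) (f : ℕ → ℕ → ℤ) (j : ℕ) :
    HOct (pushF a f j) (f j) (pushF a f (j + 1)) (f (j + 1)) := by
  intro r; simp [pushF]

theorem pushF_zero (a : ℕ → ℤ) (f : ℕ → ℕ → ℤ) (ha : a 0 = 0) (j : ℕ) : pushF a f j 0 = 0 := by
  cases j <;> simp [pushF, ha]

/-- A ballot chain of length `d`, with content `ν`. -/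
structure HChain (d : ℕ) (ν : ℕ → ℤ) (f : ℕ → ℕ → ℤ) : Prop where
  zero : ∀ k, f k 0 = 0
  strip : ∀ k, k < d → HStrip (f k) (f (k + 1))
  bal : ∀ k, k + 2 ≤ d → HBal (f k) (f (k + 1)) (f (k + 2))
  nonneg : ∀ r, f 0 r ≤ f 0 (r + 1)
  stab : ∀ k, k ≤ d → ∀ r, d ≤ r → f k (r + 1) = f k r
  cont : ∀ k, k < d → f (k + 1) d - f k d = ν k

theorem pushF_strip {d : ℕ} {ν : ℕ → ℤ} {f : ℕ → ℕ → ℤ} (hf : HChain d ν f) {a : ℕ → ℤ}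
    (ha : a 0 = 0) (hs : HStrip a (f 0)) : ∀ j, j ≤ d → HStrip (pushF a f j) (f j) := by
  intro j
  induction j with
  | zero => intro _; exact hs
  | succ j ih =>
    intro hj
    exact (HOct.strip (pushF_zero a f ha j) (hf.zero _) (pushF_zero a f ha _) (hf.zero _)
      (ih (by omega)) (hf.strip j (by omega)) (pushF_oct a f j)).2

theorem pushF_chain {d : ℕ} {ν : ℕ → ℤ} {f : ℕ → ℕ → ℤ} (hf : HChain d ν f) {a : ℕ → ℤ}
    (ha : a 0 = 0) (hs : HStrip a (f 0)) (ha0 : ∀ r, a r ≤ a (r + 1))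
    (hast : ∀ r, d ≤ r → a (r + 1) = a r) : HChain d ν (pushF a f) := by
  have hst : ∀ k, k < d → HStrip (pushF a f k) (pushF a f (k + 1)) := fun k hk =>
    (HOct.strip (pushF_zero a f ha k) (hf.zero _) (pushF_zero a f ha _) (hf.zero _)
      (pushF_strip hf ha hs k (by omega)) (hf.strip k (by omega)) (pushF_oct a f k)).1
  have hnn : ∀ k, k ≤ d → ∀ r, pushF a f k r ≤ pushF a f k (r + 1) := by
    intro k
    induction k with
    | zero => intro _; exact ha0
    | succ k ih =>
      intro hk r
      have h1 := ih (by omega) r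
      have h2 := (hst k (by omega)).1 r
      omega
  have key : ∀ k, k < d → ∀ r, d ≤ r →
      pushF a f (k + 1) r + f k r = pushF a f k r + f (k + 1) r := by
    intro k hk r hr
    obtain ⟨r, rfl⟩ : ∃ s, r = s + 1 := ⟨r - 1, by omega⟩
    have h1 := pushF_oct a f k r
    have h2 := hf.stab (k + 1) (by omega) (r + 1) hr
    have h3 := hnn k (by omega) r
    simp only [add_assoc, Nat.reduceAdd] at *
    omega
  refine ⟨pushF_zero a f ha, hst, ?_, ha0, ?_, ?_⟩
  · intro k hk
    exact HOct.bal_j (hf.zero k) (hf.zero _) (pushF_zero a f ha _) (pushF_zero a f ha _)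
      (hf.bal k hk) (pushF_oct a f k) (pushF_oct a f (k + 1))
  · intro k
    induction k with
    | zero => intro _ r hr; exact hast r hr
    | succ k ih =>
      intro hk r hr
      have h1 := ih (by omega) r hr
      have h2 := key k (by omega) r hr
      have h3 := key k (by omega) (r + 1) (by omega)
      have h4 := hf.stab k (by omega) r hr
      have h5 := hf.stab (k + 1) (by omega) r hr
      omega
  · intro k hk
    have h2 := key k (by omega) d le_rfl
    have h3 := hf.cont k hk
    omega

/-- A hive of size `d` with boundary `μ, ν, l`. -/
structure IsHive (d : ℕ) (μ ν l : ℕ → ℤ) (f : ℕ → ℕ → ℤ) : Prop extends HChain d ν f where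
  base : ∀ r, f 0 (r + 1) - f 0 r = μ r
  top : ∀ r, f d (r + 1) - f d r = l r

/-- Ballot property forces triangularity. -/
theorem ballot_tri {d : ℕ} {ν : ℕ → ℤ} {f : ℕ → ℕ → ℤ} (hf : HChain d ν f) :
    ∀ k, k < d → ∀ r, r ≤ k → f (k + 1) r = f k r := by
  have hmono : ∀ k, k < d → ∀ r, f k r ≤ f (k + 1) r := by
    intro k hk r
    induction r with
    | zero => simp [hf.zero]
    | succ r ih => have := (hf.strip k hk).1 r; omega
  intro k
  induction k with
  | zero => intro _ r hr; obtain rfl : r = 0 := by omega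
            simp [hf.zero]
  | succ k ih =>
    intro hk r hr
    rcases r with _ | r
    · simp [hf.zero]
    · have h1 := hf.bal k (by omega) r
      have h2 := ih (by omega) r (by omega)
      have h3 := hmono (k + 1) hk (r + 1)
      simp only [add_assoc, Nat.reduceAdd] at *
      omega

theorem ballot_tri' {d : ℕ} {ν : ℕ → ℤ} {f : ℕ → ℕ → ℤ} (hf : HChain d ν f) (r : ℕ) :
    ∀ k, r ≤ k → k ≤ d → f k r = f r r := by
  intro k hk
  induction k, hk using Nat.le_induction with
  | base => intro _; rfl
  | succ k hk ih => intro h; rw [ballot_tri hf k (by omega) r hk, ih (by omega)]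

theorem IsHive.diag {d : ℕ} {μ ν l : ℕ → ℤ} {f : ℕ → ℕ → ℤ} (hf : IsHive d μ ν l f) (r : ℕ)
    (hr : r < d) : f (r + 1) (r + 1) - f r r = l r := by
  rw [← hf.top r, ballot_tri' hf.toHChain r d (by omega) le_rfl,
    ballot_tri' hf.toHChain (r + 1) d (by omega) le_rfl]

/-- Partial sums of `(μ_0, …, μ_{i-1})`. -/
def truncSum (μ : ℕ → ℤ) (i r : ℕ) : ℤ := ∑ s ∈ Finset.range (min i r), μ s

theorem truncSum_succ (μ : ℕ → ℤ) (i r : ℕ) :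
    truncSum μ i (r + 1) = truncSum μ i r + if r < i then μ r else 0 := by
  unfold truncSum
  split_ifs with h
  · rw [Nat.min_eq_right (by omega), Nat.min_eq_right (by omega), Finset.sum_range_succ]
  · rw [Nat.min_eq_left (by omega), Nat.min_eq_left (by omega)]; simp

theorem truncSum_succ_left (μ : ℕ → ℤ) (i r : ℕ) :
    truncSum μ (i + 1) r = truncSum μ i r + if i < r then μ i else 0 := by
  unfold truncSum
  split_ifs with h
  · rw [Nat.min_eq_left (by omega), Nat.min_eq_left (by omega), Finset.sum_range_succ]
  · rw [Nat.min_eq_right (by omega), Nat.min_eq_right (by omega)]; simp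

/-- The grid of partitions. -/
def gridF (μ : ℕ → ℤ) (f : ℕ → ℕ → ℤ) (d : ℕ) : ℕ → ℕ → ℕ → ℤ
  | 0 => f
  | m + 1 => pushF (truncSum μ (d - (m + 1))) (gridF μ f d m)

theorem truncSum_strip {μ : ℕ → ℤ} (h0 : ∀ r, 0 ≤ μ r) (ha : ∀ r, μ (r + 1) ≤ μ r) (i : ℕ) :
    HStrip (truncSum μ i) (truncSum μ (i + 1)) := by
  constructor
  · intro r
    have := h0 r
    rw [truncSum_succ, truncSum_succ]
    split_ifs <;> omega
  · intro r
    have := h0 r; have := ha r; have := h0 (r+1)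
    rw [truncSum_succ μ (i+1) (r+1), truncSum_succ μ i r]
    split_ifs <;> omega

theorem truncSum_bal {μ : ℕ → ℤ} (h0 : ∀ r, 0 ≤ μ r) (ha : ∀ r, μ (r + 1) ≤ μ r) (i : ℕ) :
    HBal (truncSum μ i) (truncSum μ (i + 1)) (truncSum μ (i + 2)) := by
  intro r
  have := h0 i; have := ha i; have := h0 (i+1)
  rw [truncSum_succ_left μ (i+1) (r+1), truncSum_succ_left μ i r]
  split_ifs <;> omega

theorem truncSum_mono {μ : ℕ → ℤ} (h0 : ∀ r, 0 ≤ μ r) (i r : ℕ) :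
    truncSum μ i r ≤ truncSum μ i (r + 1) := by
  have := h0 r
  rw [truncSum_succ]; split_ifs <;> omega

/-- Commutativity of hives. -/
theorem IsHive.comm {d : ℕ} {μ ν l : ℕ → ℤ} {f : ℕ → ℕ → ℤ} (hf : IsHive d μ ν l f)
    (h0 : ∀ r, 0 ≤ μ r) (ha : ∀ r, μ (r + 1) ≤ μ r) (hν : ∀ r, 0 ≤ ν r)
    (hνd : ∀ r, d ≤ r → ν r = 0) : ∃ g, IsHive d ν μ l g := by
  set G := gridF μ f d with hG
  have hM0 : ∀ i, truncSum μ i 0 = 0 := fun i => by simp [truncSum]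
  have hbase0 : ∀ r, f 0 r = truncSum μ d r := by
    intro r
    induction r with
    | zero => simp [hf.zero, hM0]
    | succ r ih =>
      have h1 := hf.base r
      rw [truncSum_succ]
      split_ifs with h
      · omega
      · have := hf.stab 0 (by omega) r (by omega); omega
  have hbase : ∀ m, m ≤ d → G m 0 = truncSum μ (d - m) := by
    intro m hm
    cases m with
    | zero => funext r; exact hbase0 r
    | succ m => rfl
  have hs : ∀ m, m + 1 ≤ d → HStrip (truncSum μ (d - (m + 1))) (G m 0) := by
    intro m hm
    rw [hbase m (by omega)]
    obtain ⟨e, he⟩ : ∃ e, d = e + (m + 1) := ⟨d - (m+1), by omega⟩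
    have h1 : d - (m + 1) = e := by omega
    have h2 : d - m = e + 1 := by omega
    rw [h1, h2]; exact truncSum_strip h0 ha e
  have hch : ∀ m, m ≤ d → HChain d ν (G m) := by
    intro m
    induction m with
    | zero => intro _; exact hf.toHChain
    | succ m ih =>
      intro hm
      refine pushF_chain (ih (by omega)) (hM0 _) (hs m hm) (truncSum_mono h0 _) ?_
      intro r hr
      rw [truncSum_succ, if_neg (by omega)]; simp
  have hst : ∀ m, m + 1 ≤ d → ∀ j, j ≤ d → HStrip (G (m + 1) j) (G m j) := fun m hm j hj =>
    pushF_strip (hch m (by omega)) (hM0 _) (hs m hm) j hj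
  have hbal : ∀ m, m + 2 ≤ d → ∀ j, j ≤ d → HBal (G (m + 2) j) (G (m + 1) j) (G m j) := by
    intro m hm j
    induction j with
    | zero =>
      intro _
      rw [hbase _ hm, hbase _ (by omega), hbase _ (by omega)]
      obtain ⟨e, he⟩ : ∃ e, d = e + (m + 2) := ⟨d - (m+2), by omega⟩
      have h1 : d - (m + 2) = e := by omega
      have h2 : d - (m + 1) = e + 1 := by omega
      have h3 : d - m = e + 2 := by omega
      rw [h1, h2, h3]; exact truncSum_bal h0 ha e
    | succ j ih =>
      intro hj
      exact HOct.bal_i ((hch _ hm).zero _) ((hch (m+1) (by omega)).zero _) ((hch _ hm).zero _)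
        ((hch (m+1) (by omega)).zero _) (ih (by omega)) (pushF_oct _ _ j) (pushF_oct _ _ j)
  have hcont : ∀ m, m ≤ d → ∀ j, j ≤ d →
      G m j d = truncSum μ (d - m) d + ∑ s ∈ Finset.range j, ν s := by
    intro m hm j
    induction j with
    | zero => intro _; rw [hbase m hm]; simp
    | succ j ih =>
      intro hj
      have h1 := (hch m hm).cont j (by omega)
      rw [Finset.sum_range_succ]
      have := ih (by omega)
      omega
  -- shapes of the first chain
  have hrow : ∀ j, j ≤ d → ∀ r, j ≤ r → G d j (r + 1) = G d j r := by
    intro j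
    induction j with
    | zero => intro _ r _; rw [hbase d le_rfl]; simp [truncSum]
    | succ j ih =>
      intro hj r hr
      obtain ⟨r, rfl⟩ : ∃ s, r = s + 1 := ⟨r - 1, by omega⟩
      have h1 := ih (by omega) r (by omega)
      have h2 := ih (by omega) (r + 1) (by omega)
      have h3 := ((hch d le_rfl).strip j (by omega)).2 r
      have h4 := ((hch d le_rfl).strip j (by omega)).1 (r + 1)
      simp only [add_assoc, Nat.reduceAdd] at *
      omega
  have hrow' : ∀ j, j ≤ d → ∀ r, j ≤ r → G d j r = G d j j := by
    intro j hj r hr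
    induction r, hr using Nat.le_induction with
    | base => rfl
    | succ r hr ih => rw [hrow j hj r hr, ih]
  have hfirst : ∀ r, r ≤ d → G d d r = ∑ s ∈ Finset.range r, ν s := by
    intro r hr
    rw [ballot_tri' (hch d le_rfl) r d hr le_rfl, ← hrow' r hr d hr, hcont d le_rfl r hr]
    simp [truncSum]
  have hfirst' : ∀ r, G d d (r + 1) - G d d r = ν r := by
    intro r
    by_cases hr : r < d
    · rw [hfirst r (by omega), hfirst (r + 1) (by omega), Finset.sum_range_succ]; ring
    · rw [hrow d le_rfl r (by omega), hνd r (by omega)]; ring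
  have hgap : ∀ k, k < d → ∃ m, d - k = m + 1 ∧ d - (k + 1) = m ∧ m + 1 ≤ d := fun k hk =>
    ⟨d - (k + 1), by omega, rfl, by omega⟩
  refine ⟨fun k => G (d - k) d, ⟨?_, ?_, ?_, ?_, ?_, ?_⟩, ?_, ?_⟩
  · intro k; exact (hch _ (by omega)).zero _
  · intro k hk
    obtain ⟨m, h1, h2, h3⟩ := hgap k hk
    simp only [h1, h2]; exact hst m h3 d le_rfl
  · intro k hk
    obtain ⟨m, h1, h2, h3⟩ : ∃ m, d - k = m + 2 ∧ d - (k + 1) = m + 1 ∧ d - (k + 2) = m :=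
      ⟨d - (k + 2), by omega, by omega, rfl⟩
    simp only [h1, h2, h3]; exact hbal m (by omega) d le_rfl
  · intro r
    have h1 := hfirst' r; have h2 := hν r
    simp only [Nat.sub_zero]; omega
  · intro k hk r hr
    exact (hch _ (by omega)).stab d le_rfl r hr
  · intro k hk
    rw [hcont _ (by omega) d le_rfl, hcont _ (by omega) d le_rfl,
      show d - (d - (k + 1)) = k + 1 by omega, show d - (d - k) = k by omega,
      truncSum_succ_left, if_pos hk]
    ring
  · intro r; simpa using hfirst' r
  · intro r; simp only [Nat.sub_self]; exact hf.top r

/-! ### Overlaying a honeycomb on a hive -/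

theorem hive_overlay (h : ℕ → ℕ → ℤ)
    (h1 : ∀ k r, h k (r + 1) - h k r ≤ h (k + 1) (r + 1) - h (k + 1) r)
    (h2 : ∀ k r, h (k + 1) (r + 2) - h (k + 1) (r + 1) ≤ h k (r + 1) - h k r)
    (h3 : ∀ k r, h (k + 2) (r + 1) - h (k + 1) (r + 1) ≤ h (k + 1) r - h k r)
    (d : ℕ) (p q : ℕ → ℕ → ℕ) (a c : ℕ → ℕ)
    (hX : ∀ I K, I + 1 < d → K ≤ I →
      p (I + 1) (K + 1) + (q I K + 1) = p (I + 1) K + q (I + 1) (K + 1) ∧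
        p (I + 1) K ≤ p (I + 1) (K + 1))
    (hX0 : ∀ I, I < d → p I 0 = q I 0 + a I)
    (hY : ∀ I K, I + 1 < d → K ≤ I → p I K + 1 ≤ p (I + 1) K)
    (hZ : ∀ I K, I + 1 < d → K ≤ I → q (I + 1) K ≤ q I K)
    (hZ0 : ∀ I, I < d → p I I = c I ∧ q I I ≤ c I) :
    ∀ I, I < d → ∑ t ∈ Finset.range (I + 1), (h (c t + 1) (c t + 1) - h (c t) (c t)) ≤
      ∑ t ∈ Finset.range (I + 1), (h 0 (a t + 1) - h 0 (a t)) +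
      ∑ K ∈ Finset.range (I + 1), (h (q I K + 1) (p I K + 1) - h (q I K) (p I K + 1)) := by
  have hx : ∀ m k r, h (k + m) (r + m + 1) - h (k + m) (r + m) ≤ h k (r + 1) - h k r := by
    intro m k r
    induction m with
    | zero => simp
    | succ m ih => have := h2 (k + m) (r + m); simp only [add_assoc, Nat.reduceAdd] at *; omega
  have hy : ∀ m k r, h (k + 1) r - h k r ≤ h (k + 1) (r + m) - h k (r + m) := by
    intro m k r
    induction m with
    | zero => simp
    | succ m ih => have := h1 k (r + m); simp only [add_assoc, Nat.reduceAdd] at *; omega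
  have hz : ∀ m k r, h (k + m + 1) (r + 1) - h (k + m) r ≤ h (k + 1) (r + 1) - h k r := by
    intro m k r
    induction m with
    | zero => simp
    | succ m ih => have := h3 (k + m) r; simp only [add_assoc, Nat.reduceAdd] at *; omega
  have hzc : ∀ I, I < d → h (c I + 1) (c I + 1) - h (c I) (c I) ≤
      h (q I I + 1) (p I I + 1) - h (q I I) (p I I) := by
    intro I hI
    obtain ⟨e1, e2⟩ := hZ0 I hI
    obtain ⟨m, hm⟩ := Nat.exists_eq_add_of_le e2
    have := hz m (q I I) (c I)
    rw [e1]
    rw [← hm] at this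
    exact this
  have hxa : ∀ I, I < d → h (q I 0) (p I 0 + 1) - h (q I 0) (p I 0) ≤
      h 0 (a I + 1) - h 0 (a I) := by
    intro I hI
    have := hx (q I 0) 0 (a I)
    rw [hX0 I hI, add_comm (q I 0) (a I)]
    simpa using this
  intro I
  induction I with
  | zero =>
    intro hd
    have e1 := hzc 0 hd
    have e2 := hxa 0 hd
    simp only [zero_add, Finset.sum_range_one]
    omega
  | succ I ih =>
    intro hd
    have ih := ih (by omega)
    rw [Finset.sum_range_succ _ (I + 1), Finset.sum_range_succ (fun t => h 0 (a t + 1) - h 0 (a t)) (I + 1)]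
    have e1 := hzc (I + 1) hd
    have e2 := hxa (I + 1) hd
    -- row identity
    have id1 : ∑ K ∈ Finset.range (I + 2),
          (h (q (I+1) K + 1) (p (I+1) K + 1) - h (q (I+1) K) (p (I+1) K)) =
        ∑ K ∈ Finset.range (I + 2), (h (q (I+1) K) (p (I+1) K + 1) - h (q (I+1) K) (p (I+1) K)) +
        ∑ K ∈ Finset.range (I + 2),
          (h (q (I+1) K + 1) (p (I+1) K + 1) - h (q (I+1) K) (p (I+1) K + 1)) := by
      rw [← Finset.sum_add_distrib]
      exact Finset.sum_congr rfl fun K _ => by ring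
    rw [Finset.sum_range_succ _ (I + 1), Finset.sum_range_succ'
      (fun K => h (q (I+1) K) (p (I+1) K + 1) - h (q (I+1) K) (p (I+1) K)) (I + 1)] at id1
    have lZ : ∑ K ∈ Finset.range (I + 1), (h (q I K + 1) (p (I+1) K + 1) - h (q I K) (p (I+1) K)) ≤
        ∑ K ∈ Finset.range (I + 1),
          (h (q (I+1) K + 1) (p (I+1) K + 1) - h (q (I+1) K) (p (I+1) K)) := by
      refine Finset.sum_le_sum fun K hK => ?_
      rw [Finset.mem_range] at hK
      obtain ⟨m, hm⟩ := Nat.exists_eq_add_of_le (hZ I K hd (by omega))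
      rw [hm]; exact hz m _ _
    have lX : ∑ K ∈ Finset.range (I + 1),
          (h (q (I+1) (K+1)) (p (I+1) (K+1) + 1) - h (q (I+1) (K+1)) (p (I+1) (K+1))) ≤
        ∑ K ∈ Finset.range (I + 1),
          (h (q I K + 1) (p (I+1) K + 1) - h (q I K + 1) (p (I+1) K)) := by
      refine Finset.sum_le_sum fun K hK => ?_
      rw [Finset.mem_range] at hK
      obtain ⟨f1, f2⟩ := hX I K hd (by omega)
      obtain ⟨m, hm⟩ := Nat.exists_eq_add_of_le f2
      have hq : q (I+1) (K+1) = q I K + 1 + m := by omega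
      rw [hm, hq]; exact hx m _ _
    have lY : ∑ K ∈ Finset.range (I + 1), (h (q I K + 1) (p I K + 1) - h (q I K) (p I K + 1)) ≤
        ∑ K ∈ Finset.range (I + 1), (h (q I K + 1) (p (I+1) K) - h (q I K) (p (I+1) K)) := by
      refine Finset.sum_le_sum fun K hK => ?_
      rw [Finset.mem_range] at hK
      obtain ⟨m, hm⟩ := Nat.exists_eq_add_of_le (hY I K hd (by omega))
      rw [hm]; exact hy m _ _
    have id2 : ∑ K ∈ Finset.range (I + 1), (h (q I K + 1) (p (I+1) K + 1) - h (q I K) (p (I+1) K)) =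
        ∑ K ∈ Finset.range (I + 1), (h (q I K + 1) (p (I+1) K + 1) - h (q I K + 1) (p (I+1) K)) +
        ∑ K ∈ Finset.range (I + 1), (h (q I K + 1) (p (I+1) K) - h (q I K) (p (I+1) K)) := by
      rw [← Finset.sum_add_distrib]
      exact Finset.sum_congr rfl fun K _ => by ring
    linarith

/-! ### From LR fillings to hives -/

/-- Number of cells in row `s` with entry at most `k` (including cells of `μ`). -/
def fillRow {μ ν lam : YoungDiagram} (T : LRFilling μ ν lam) (k s : ℕ) : ℕ :=
  ((Finset.range (lam.rowLen s)).filter (fun j => T.T s j ≤ k)).card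

/-- Number of cells in row `s` with entry equal to `k`. -/
def fillEq {μ ν lam : YoungDiagram} (T : LRFilling μ ν lam) (k s : ℕ) : ℕ :=
  ((Finset.range (lam.rowLen s)).filter (fun j => T.T s j = k)).card

theorem fillRow_succ {μ ν lam : YoungDiagram} (T : LRFilling μ ν lam) (k s : ℕ) :
    fillRow T (k + 1) s = fillRow T k s + fillEq T (k + 1) s := by
  unfold fillRow fillEq
  rw [← Finset.card_union_of_disjoint]
  · congr 1; ext j; simp only [Finset.mem_filter, Finset.mem_union]; grind
  · rw [Finset.disjoint_left]; intro j; simp only [Finset.mem_filter]; omega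

theorem LRFilling.lt_of_ne {μ ν lam : YoungDiagram} (T : LRFilling μ ν lam) {i j : ℕ}
    (h : T.T i j ≠ 0) : j < lam.rowLen i :=
  YoungDiagram.mem_iff_lt_rowLen.1 ((T.supp i j).1 h).1

theorem fillRow_strip {μ ν lam : YoungDiagram} (T : LRFilling μ ν lam) (k s : ℕ) :
    fillRow T (k + 1) (s + 1) ≤ fillRow T k s := by
  unfold fillRow
  refine Finset.card_le_card fun j => ?_
  simp only [Finset.mem_filter, Finset.mem_range]
  rintro ⟨h1, h2⟩
  have h3 : j < lam.rowLen s := lt_of_lt_of_le h1 (lam.rowLen_anti s (s + 1) (by omega))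
  refine ⟨h3, ?_⟩
  by_cases h0 : T.T s j = 0
  · omega
  · have hnm := ((T.supp s j).1 h0).2
    have h0' : T.T (s + 1) j ≠ 0 := by
      rw [T.supp]
      refine ⟨YoungDiagram.mem_iff_lt_rowLen.2 h1, fun hm => hnm ?_⟩
      exact μ.up_left_mem (by omega) le_rfl hm
    have := T.cols_strict s (s + 1) j (by omega) h0 h0'
    omega

theorem fillRow_zero {μ ν lam : YoungDiagram} (T : LRFilling μ ν lam) (s : ℕ) :
    fillRow T 0 s = μ.rowLen s := by
  unfold fillRow
  rw [show (Finset.range (lam.rowLen s)).filter (fun j => T.T s j ≤ 0) =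
    Finset.range (μ.rowLen s) from ?_, Finset.card_range]
  ext j
  simp only [Finset.mem_filter, Finset.mem_range, ← YoungDiagram.mem_iff_lt_rowLen]
  have h := T.supp s j
  constructor
  · rintro ⟨h1, h2⟩
    by_contra h3
    exact (h.2 ⟨h1, h3⟩) (by omega)
  · intro h1
    refine ⟨T.sub h1, ?_⟩
    by_contra h3
    exact (h.1 (by omega)).2 h1

/-- Cells in rows `< r` with entry `k+1`, as a finset. -/
theorem sum_fillEq {μ ν lam : YoungDiagram} (T : LRFilling μ ν lam) (k r : ℕ) :
    ∑ s ∈ Finset.range r, fillEq T (k + 1) s =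
      Nat.card {p : ℕ × ℕ // p.1 < r ∧ T.T p.1 p.2 = k + 1} := by
  have h : ∀ p : ℕ × ℕ, p ∈ ((Finset.range r).sigma fun s =>
      (Finset.range (lam.rowLen s)).filter (fun j => T.T s j = k + 1)).map
        (Equiv.sigmaEquivProd ℕ ℕ).toEmbedding ↔ p.1 < r ∧ T.T p.1 p.2 = k + 1 := by
    rintro ⟨i, j⟩
    simp only [Finset.mem_map_equiv, Finset.mem_sigma, Finset.mem_filter, Finset.mem_range,
      Equiv.sigmaEquivProd_symm_apply]
    constructor
    · rintro ⟨h1, h2, h3⟩; exact ⟨h1, h3⟩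
    · rintro ⟨h1, h3⟩; exact ⟨h1, T.lt_of_ne (by omega), h3⟩
  rw [← Nat.card_congr (Equiv.subtypeEquivRight h), Nat.card_eq_fintype_card, Fintype.card_coe,
    Finset.card_map, Finset.card_sigma]
  rfl

theorem fill_ballot {μ ν lam : YoungDiagram} (T : LRFilling μ ν lam) (k r : ℕ) :
    ∑ s ∈ Finset.range (r + 1), fillEq T (k + 2) s ≤ ∑ s ∈ Finset.range r, fillEq T (k + 1) s := by
  obtain ⟨j0, hj1, hj2⟩ : ∃ j0, (∀ j, T.T r j = k + 2 → j0 ≤ j) ∧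
      (∀ j, T.T r j = k + 1 → j < j0) := by
    by_cases h : ∃ j, T.T r j = k + 2
    · classical
      refine ⟨Nat.find h, fun j hj => Nat.find_min' h hj, fun j hj => ?_⟩
      by_contra hlt
      have h1 := Nat.find_spec h
      have := T.rows_weak r _ j (not_lt.1 hlt) (by omega) (by omega)
      omega
    · push Not at h
      exact ⟨lam.rowLen r, fun j hj => absurd hj (h j), fun j hj => T.lt_of_ne (by omega)⟩
  have hb := T.ballot r j0 k
  rw [sum_fillEq T (k + 1) (r + 1), sum_fillEq T k r]
  have e1 : Nat.card {p : ℕ × ℕ // (p.1 < r ∨ (p.1 = r ∧ j0 ≤ p.2)) ∧ T.T p.1 p.2 = k + 2} =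
      Nat.card {p : ℕ × ℕ // p.1 < r + 1 ∧ T.T p.1 p.2 = k + 1 + 1} := by
    refine Nat.card_congr (Equiv.subtypeEquivRight ?_)
    rintro ⟨i, j⟩
    constructor
    · rintro ⟨h1, h2⟩; exact ⟨by simp only at h1 ⊢; omega, h2⟩
    · rintro ⟨h1, h2⟩
      refine ⟨?_, h2⟩
      simp only at h1 h2 ⊢
      rcases Nat.lt_succ_iff_lt_or_eq.1 h1 with h | h
      · exact Or.inl h
      · subst h; exact Or.inr ⟨rfl, hj1 j h2⟩
  have e2 : Nat.card {p : ℕ × ℕ // (p.1 < r ∨ (p.1 = r ∧ j0 ≤ p.2)) ∧ T.T p.1 p.2 = k + 1} =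
      Nat.card {p : ℕ × ℕ // p.1 < r ∧ T.T p.1 p.2 = k + 1} := by
    refine Nat.card_congr (Equiv.subtypeEquivRight ?_)
    rintro ⟨i, j⟩
    constructor
    · rintro ⟨h1, h2⟩
      refine ⟨?_, h2⟩
      simp only at h1 h2 ⊢
      rcases h1 with h | ⟨h, h'⟩
      · exact h
      · subst h; have := hj2 j h2; omega
    · rintro ⟨h1, h2⟩; exact ⟨Or.inl h1, h2⟩
  rw [← e1, ← e2]; exact hb

theorem fill_content {μ ν lam : YoungDiagram} (T : LRFilling μ ν lam) (k d : ℕ)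
    (hd : lam.colLen 0 ≤ d) : ∑ s ∈ Finset.range d, fillEq T (k + 1) s = ν.rowLen k := by
  rw [sum_fillEq, ← T.content k]
  refine Nat.card_congr (Equiv.subtypeEquivRight ?_)
  rintro ⟨i, j⟩
  refine ⟨fun h => h.2, fun h => ⟨?_, h⟩⟩
  simp only at h ⊢
  have h1 := ((T.supp i j).1 (by omega)).1
  have h2 := YoungDiagram.mem_iff_lt_colLen.1 (lam.up_left_mem le_rfl (Nat.zero_le j) h1)
  omega

theorem rowLen_eq_zero (lam : YoungDiagram) {d r : ℕ} (hd : lam.colLen 0 ≤ d) (hr : d ≤ r) :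
    lam.rowLen r = 0 := by
  by_contra h
  have h1 : (r, 0) ∈ lam := YoungDiagram.mem_iff_lt_rowLen.2 (by omega)
  have h2 := YoungDiagram.mem_iff_lt_colLen.1 h1
  omega

theorem filling_hive {μ ν lam : YoungDiagram} (T : LRFilling μ ν lam) :
    ∃ f : ℕ → ℕ → ℤ, ∀ d, lam.colLen 0 ≤ d →
      IsHive d (fun r => (μ.rowLen r : ℤ)) (fun r => (ν.rowLen r : ℤ))
        (fun r => (lam.rowLen r : ℤ)) f := by
  set f : ℕ → ℕ → ℤ := fun k r => ∑ s ∈ Finset.range r, (fillRow T k s : ℤ) with hf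
  have hdiff : ∀ k r, f k (r + 1) - f k r = fillRow T k r := by
    intro k r; simp [hf, Finset.sum_range_succ]
  have hstep : ∀ k r, f (k + 1) r - f k r = ((∑ s ∈ Finset.range r, fillEq T (k + 1) s : ℕ) : ℤ) := by
    intro k r
    simp only [hf, fillRow_succ, Nat.cast_add, Finset.sum_add_distrib, Nat.cast_sum]
    ring
  have hch : ∀ d, lam.colLen 0 ≤ d → HChain d (fun r => (ν.rowLen r : ℤ)) f := by
    intro d hd
    refine ⟨fun k => by simp [hf], fun k _ => ⟨fun r => ?_, fun r => ?_⟩, fun k _ r => ?_,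
      fun r => ?_, fun k _ r hr => ?_, fun k _ => ?_⟩
    · rw [hdiff, hdiff, fillRow_succ]; push_cast; omega
    · rw [hdiff (k + 1) (r + 1), hdiff]; exact_mod_cast fillRow_strip T k r
    · rw [hstep (k + 1) (r + 1), hstep]; exact_mod_cast fill_ballot T k r
    · have := hdiff 0 r; omega
    · have := hdiff k r
      have h0 : fillRow T k r = 0 := by
        unfold fillRow; rw [rowLen_eq_zero lam hd hr]; simp
      omega
    · rw [hstep, fill_content T k d hd]
  refine ⟨f, fun d hd => ⟨hch d hd, fun r => ?_, fun r => ?_⟩⟩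
  · rw [hdiff, fillRow_zero]
  · rw [hdiff]
    by_cases hr : d ≤ r
    · unfold fillRow; rw [rowLen_eq_zero lam hd hr]; simp
    · set m := (Finset.range (lam.rowLen r)).sup (fun j => T.T r j) with hm
      have h1 : fillRow T (max m d) r = lam.rowLen r := by
        unfold fillRow
        rw [Finset.filter_true_of_mem, Finset.card_range]
        intro j hj
        exact le_trans (Finset.le_sup (f := fun j => T.T r j) hj) (le_max_left _ _)
      rw [← h1]
      have hc := hch (max m d) (le_trans hd (le_max_right _ _))
      have hdm : d ≤ max m d := le_max_right _ _
      rw [← hdiff, ← hdiff, ballot_tri' hc (r + 1) d (by omega) (by omega),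
        ballot_tri' hc (r + 1) (max m d) (by omega) le_rfl,
        ballot_tri' hc r d (by omega) (by omega),
        ballot_tri' hc r (max m d) (by omega) le_rfl]

theorem colLen_le_of_rowLen (lam : YoungDiagram) {d : ℕ} (h : lam.rowLen d = 0) :
    lam.colLen 0 ≤ d := by
  by_contra hlt
  have h1 : (d, 0) ∈ lam := YoungDiagram.mem_iff_lt_colLen.2 (by omega)
  have h2 := YoungDiagram.mem_iff_lt_rowLen.1 h1
  omega

theorem content_le {μ ν lam : YoungDiagram} (T : LRFilling μ ν lam) (r : ℕ) :
    ν.rowLen r ≤ lam.rowLen r := by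
  obtain ⟨f, hf⟩ := filling_hive T
  set N := max (lam.colLen 0) (ν.colLen 0)
  obtain ⟨g, hg⟩ := (hf N (le_max_left _ _)).comm (fun r => by simp)
    (fun r => by exact_mod_cast μ.rowLen_anti r (r + 1) (by omega)) (fun r => by simp)
    (fun r hr => by simp [rowLen_eq_zero ν (le_max_right _ _) hr])
  have h : ∀ k, k ≤ N → g 0 (r + 1) - g 0 r ≤ g k (r + 1) - g k r := by
    intro k
    induction k with
    | zero => intro _; exact le_rfl
    | succ k ih =>
      intro hk
      have := ih (by omega)
      have := (hg.strip k (by omega)).1 r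
      omega
  have h1 := h N le_rfl
  rw [hg.base, hg.top] at h1
  exact_mod_cast h1

/-- The Horn inequality for a hive `h`, from a hive `g` with (swapped) boundary `TJ, TI, TK`. -/
theorem hive_horn {d : ℕ} (hd : 0 < d) {TI TJ TK β γ lam : YoungDiagram} {g h : ℕ → ℕ → ℤ}
    (hg : IsHive d (fun r => (TJ.rowLen r : ℤ)) (fun r => (TI.rowLen r : ℤ))
      (fun r => (TK.rowLen r : ℤ)) g)
    (hh : ∀ d, lam.colLen 0 ≤ d → IsHive d (fun r => (β.rowLen r : ℤ)) (fun r => (γ.rowLen r : ℤ))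
      (fun r => (lam.rowLen r : ℤ)) h) :
    ∑ t ∈ Finset.range d, (lam.rowLen (TK.rowLen (d - 1 - t) + t) : ℤ) ≤
      ∑ t ∈ Finset.range d, (β.rowLen (TI.rowLen (d - 1 - t) + t) : ℤ) +
      ∑ t ∈ Finset.range d, (γ.rowLen (TJ.rowLen (d - 1 - t) + t) : ℤ) := by
  have h1 : ∀ k r, h k (r + 1) - h k r ≤ h (k + 1) (r + 1) - h (k + 1) r := fun k r =>
    ((hh (lam.colLen 0 + k + 1) (by omega)).strip k (by omega)).1 r
  have h2 : ∀ k r, h (k + 1) (r + 2) - h (k + 1) (r + 1) ≤ h k (r + 1) - h k r := fun k r =>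
    ((hh (lam.colLen 0 + k + 1) (by omega)).strip k (by omega)).2 r
  have h3 : ∀ k r, h (k + 2) (r + 1) - h (k + 1) (r + 1) ≤ h (k + 1) r - h k r := fun k r =>
    (hh (lam.colLen 0 + k + 2) (by omega)).bal k (by omega) r
  have hdiag : ∀ r, h (r + 1) (r + 1) - h r r = lam.rowLen r := fun r =>
    (hh (lam.colLen 0 + r + 1) (by omega)).diag r (by omega)
  have hbase : ∀ r, h 0 (r + 1) - h 0 r = β.rowLen r := fun r =>
    (hh (lam.colLen 0) le_rfl).base r
  have hcont : ∀ k r, h (k + 1) r - h k r ≤ γ.rowLen k := by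
    intro k r
    have e1 := (hh (lam.colLen 0 + k + 1 + r) (by omega)).cont k (by omega)
    have hy : ∀ m, h (k + 1) r - h k r ≤ h (k + 1) (r + m) - h k (r + m) := by
      intro m
      induction m with
      | zero => simp
      | succ m ih => have := h1 k (r + m); simp only [add_assoc, Nat.reduceAdd] at *; omega
    have e2 := hy (lam.colLen 0 + k + 1)
    rw [show r + (lam.colLen 0 + k + 1) = lam.colLen 0 + k + 1 + r by omega] at e2
    omega
  -- nonnegativity of rows and counts in `g`
  have gnn : ∀ k, k ≤ d → ∀ r, 0 ≤ g k (r + 1) - g k r := by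
    intro k
    induction k with
    | zero => intro _ r; have := hg.nonneg r; omega
    | succ k ih => intro hk r; have := ih (by omega) r; have := (hg.strip k (by omega)).1 r; omega
  have gmono : ∀ k, k < d → ∀ r, g k r ≤ g (k + 1) r := by
    intro k hk r
    induction r with
    | zero => simp [hg.zero]
    | succ r ih => have := (hg.strip k hk).1 r; omega
  set q : ℕ → ℕ → ℕ := fun I K =>
    K + (g (d - 1 - I) (d - 1 - K + 1) - g (d - 1 - I) (d - 1 - K)).toNat with hq
  set p : ℕ → ℕ → ℕ := fun I K =>
    I + (g (d - 1 - I + 1) (d - 1 - K + 1) - g (d - 1 - I) (d - 1 - K)).toNat with hp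
  have hqz : ∀ I K, (q I K : ℤ) =
      K + (g (d - 1 - I) (d - 1 - K + 1) - g (d - 1 - I) (d - 1 - K)) := by
    intro I K
    have := gnn (d - 1 - I) (by omega) (d - 1 - K)
    simp only [hq]; rw [Nat.cast_add, Int.toNat_of_nonneg this]
  have hpz : ∀ I K, (p I K : ℤ) =
      I + (g (d - 1 - I + 1) (d - 1 - K + 1) - g (d - 1 - I) (d - 1 - K)) := by
    intro I K
    have e1 := gnn (d - 1 - I) (by omega) (d - 1 - K)
    have e2 := gmono (d - 1 - I) (by omega) (d - 1 - K + 1)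
    simp only [hp]; rw [Nat.cast_add, Int.toNat_of_nonneg (by omega)]
  clear_value p q
  have key := hive_overlay h h1 h2 h3 d p q (fun t => TI.rowLen (d - 1 - t) + t)
    (fun t => TK.rowLen (d - 1 - t) + t) ?_ ?_ ?_ ?_ ?_ (d - 1) (by omega)
  · rw [show d - 1 + 1 = d by omega] at key
    simp only [hdiag, hbase] at key
    refine key.trans ?_
    gcongr with K hK
    rw [Finset.mem_range] at hK
    refine (hcont _ _).trans (le_of_eq ?_)
    have e1 := hqz (d - 1) K
    have e2 := hg.base (d - 1 - K)
    rw [Nat.sub_self] at e1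
    rw [show q (d - 1) K = TJ.rowLen (d - 1 - K) + K by omega]
  · intro I K hI hK
    have a1 := hpz (I + 1) (K + 1)
    have a2 := hpz (I + 1) K
    have a3 := hqz (I + 1) (K + 1)
    have a4 := hqz I K
    obtain ⟨e, he⟩ : ∃ e, d - 1 - (I + 1) = e := ⟨_, rfl⟩
    obtain ⟨f, hf⟩ : ∃ f, d - 1 - (K + 1) = f := ⟨_, rfl⟩
    have he' : d - 1 - I = e + 1 := by omega
    have hf' : d - 1 - K = f + 1 := by omega
    rw [he, hf] at a1 a3
    rw [he, hf'] at a2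
    rw [he', hf'] at a4
    have b1 := (hg.strip e (by omega)).2 f
    push_cast at a1 a2 a3 a4
    simp only [add_assoc, Nat.reduceAdd] at *
    omega
  · intro I hI
    have a1 := hpz I 0
    have a2 := hqz I 0
    have b1 := hg.cont (d - 1 - I) (by omega)
    rw [Nat.sub_zero, show d - 1 + 1 = d by omega] at a1 a2
    omega
  · intro I K hI hK
    have a1 := hpz (I + 1) K
    have a2 := hpz I K
    obtain ⟨e, he⟩ : ∃ e, d - 1 - (I + 1) = e := ⟨_, rfl⟩
    have he' : d - 1 - I = e + 1 := by omega
    rw [he] at a1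
    rw [he'] at a2
    have b1 := hg.bal e (by omega) (d - 1 - K)
    push_cast at a1 a2
    simp only [add_assoc, Nat.reduceAdd] at *
    omega
  · intro I K hI hK
    have a1 := hqz (I + 1) K
    have a2 := hqz I K
    obtain ⟨e, he⟩ : ∃ e, d - 1 - (I + 1) = e := ⟨_, rfl⟩
    have he' : d - 1 - I = e + 1 := by omega
    rw [he] at a1
    rw [he'] at a2
    have b1 := (hg.strip e (by omega)).1 (d - 1 - K)
    omega
  · intro I hI
    have a1 := hpz I I
    have a2 := hqz I I
    have b1 := hg.diag (d - 1 - I) (by omega)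
    have b2 := gmono (d - 1 - I) (by omega) (d - 1 - I + 1)
    omega

/-- Horn inequalities for Newell–Littlewood nonvanishing:
Let `μ, ν, lam` have at most `n` parts and suppose `N_{μ,ν,lam} > 0`.  For `d < n`,
let `I, J, K ⊆ {1,…,n}` have cardinality `d`; they are encoded by their increasing
enumerations `a, b, c : Fin d → ℕ` (strictly monotone with values in `[1, n]`).
For a subset `I = {i_1 < … < i_d}` the partition `τ(I) = (i_d - d ≥ … ≥ i_1 - 1)` is
encoded as the Young diagram `TI` whose row `d - 1 - t` has length `a t - (t + 1)`
(for `t : Fin d`) and whose rows of index `≥ d` are empty.  If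
`c^{τ(K)}_{τ(I),τ(J)} > 0`, then `Σ_{k∈K} lam_k ≤ Σ_{i∈I} μ_i + Σ_{j∈J} ν_j`. -/
theorem NL_horn (n d : ℕ) (hdn : d < n) (μ ν lam : YoungDiagram)
    (hμ : μ.colLen 0 ≤ n) (hν : ν.colLen 0 ≤ n) (hlam : lam.colLen 0 ≤ n)
    (hNL : 0 < NL μ ν lam)
    (a b c : Fin d → ℕ)
    (ha : StrictMono a) (hb : StrictMono b) (hc : StrictMono c)
    (ha' : ∀ t, a t ∈ Finset.Icc 1 n) (hb' : ∀ t, b t ∈ Finset.Icc 1 n)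
    (hc' : ∀ t, c t ∈ Finset.Icc 1 n)
    (TI TJ TK : YoungDiagram)
    (hTI : (∀ t : Fin d, TI.rowLen (d - 1 - (t : ℕ)) + ((t : ℕ) + 1) = a t) ∧
      ∀ r, d ≤ r → TI.rowLen r = 0)
    (hTJ : (∀ t : Fin d, TJ.rowLen (d - 1 - (t : ℕ)) + ((t : ℕ) + 1) = b t) ∧
      ∀ r, d ≤ r → TJ.rowLen r = 0)
    (hTK : (∀ t : Fin d, TK.rowLen (d - 1 - (t : ℕ)) + ((t : ℕ) + 1) = c t) ∧
      ∀ r, d ≤ r → TK.rowLen r = 0)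
    (hLR : 0 < lrCoeff TI TJ TK) :
    ∑ t : Fin d, lam.rowLen (c t - 1) ≤
      (∑ t : Fin d, μ.rowLen (a t - 1)) + ∑ t : Fin d, ν.rowLen (b t - 1) := by 
  obtain ⟨⟨α, β, γ, T1, T2, T3⟩⟩ := (Nat.card_pos_iff.1 hNL).1
  obtain ⟨T4⟩ := (Nat.card_pos_iff.1 hLR).1
  rcases Nat.eq_zero_or_pos d with rfl | hd0
  · simp
  obtain ⟨f, hf⟩ := filling_hive T4
  obtain ⟨g, hg⟩ := (hf d (colLen_le_of_rowLen TK (hTK.2 d le_rfl))).comm (fun r => by simp)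
    (fun r => by exact_mod_cast TI.rowLen_anti r (r + 1) (by omega)) (fun r => by simp)
    (fun r hr => by simp [hTJ.2 r hr])
  obtain ⟨h, hh⟩ := filling_hive T3
  have key := hive_horn hd0 hg hh
  have ea : ∀ t : Fin d, a t - 1 = TI.rowLen (d - 1 - t) + t := fun t => by
    have := hTI.1 t; omega
  have eb : ∀ t : Fin d, b t - 1 = TJ.rowLen (d - 1 - t) + t := fun t => by
    have := hTJ.1 t; omega
  have ec : ∀ t : Fin d, c t - 1 = TK.rowLen (d - 1 - t) + t := fun t => by
    have := hTK.1 t; omega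
  simp only [ea, eb, ec]
  have k1 : ∑ t : Fin d, β.rowLen (TI.rowLen (d - 1 - t) + t) ≤
      ∑ t : Fin d, μ.rowLen (TI.rowLen (d - 1 - t) + t) :=
    Finset.sum_le_sum fun t _ => content_le T1 _
  have k2 : ∑ t : Fin d, γ.rowLen (TJ.rowLen (d - 1 - t) + t) ≤
      ∑ t : Fin d, ν.rowLen (TJ.rowLen (d - 1 - t) + t) :=
    Finset.sum_le_sum fun t _ => content_le T2 _
  simp only [Finset.sum_range] at key
  have key' : ∑ t : Fin d, lam.rowLen (TK.rowLen (d - 1 - t) + t) ≤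
      ∑ t : Fin d, β.rowLen (TI.rowLen (d - 1 - t) + t) +
      ∑ t : Fin d, γ.rowLen (TJ.rowLen (d - 1 - t) + t) := by exact_mod_cast key
  omega
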